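/- Fix k ≥ 1 and x > 0, and for p ∈ (0, 1/(k+1)) let f_{p,2,k+1} denote the density of p(X_1 + X_2) + ((1−p)/k)(Y_1 + … + Y_{k+1}) where X_1, X_2, Y_1, …, Y_{k+1} are i.i.d. Exp(1). Then there do not exist distinct p, q ∈ (0, 1/(k+1)) such that f'_{p,2,k+1}(x) = 0 and f'_{q,2,k+1}(x) = 0; equivalently, the map assigning to p ∈ (0, 1/(k+1)) the unique mode x*(p) of f_{p,2,k+1} is injective (indeed strictly increasing). -/

import Mathlib

open MeasureTheory ProbabilityTheory Finset

/-- The law of `(X_1, …, X_t)` where the `X_i` are i.i.d. `Exp(1)`. -/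
noncomputable def expLaw (t : ℕ) : Measure (Fin t → ℝ) :=
  Measure.pi fun _ => expMeasure 1

/-- The law of `p(X₁+X₂) + ((1−p)/k)(Y₁+⋯+Y_{k+1})` where `X₁,X₂,Y₁,…,Y_{k+1}` are i.i.d.
`Exp(1)`. -/
noncomputable def mixedLaw (k : ℕ) (p : ℝ) : Measure ℝ :=
  Measure.map (fun v : (Fin 2 → ℝ) × (Fin (k + 1) → ℝ) =>
      p * (v.1 0 + v.1 1) + ((1 - p) / k) * ∑ j, v.2 j)
    ((expLaw 2).prod (expLaw (k + 1)))

/-- The moment integral `∫₀¹ (1 - u) u ^ j e ^ {g u} du` of an exponentially tilted beta weight. -/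
noncomputable def betaExp (j : ℕ) (g : ℝ) : ℝ :=
  ∫ u in (0 : ℝ)..1, (1 - u) * u ^ j * Real.exp (g * u)

lemma betaExp_pos (j : ℕ) (g : ℝ) : 0 < betaExp j g := by
  refine intervalIntegral.intervalIntegral_pos_of_pos_on
    (Continuous.intervalIntegrable (by fun_prop) _ _) (fun u hu => ?_) one_pos
  have h₁ : 0 < 1 - u := by linarith [hu.2]
  have h₂ : 0 < u := hu.1
  positivity

lemma hasDerivAt_betaExp (j : ℕ) (g : ℝ) : HasDerivAt (betaExp j) (betaExp (j + 1) g) g := by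
  refine (intervalIntegral.hasDerivAt_integral_of_dominated_loc_of_deriv_le
    (F := fun g u : ℝ => (1 - u) * u ^ j * Real.exp (g * u))
    (F' := fun g u : ℝ => (1 - u) * u ^ (j + 1) * Real.exp (g * u))
    (bound := fun _ => Real.exp (|g| + 1))
    (Metric.ball_mem_nhds g one_pos) (.of_forall fun h => ?_)
    (Continuous.intervalIntegrable (by fun_prop) _ _) ?_
    (.of_forall fun u hu h hh => ?_) (by simp) (.of_forall fun u hu h hh => ?_)).2
  · exact Continuous.aestronglyMeasurable (by fun_prop)
  · exact Continuous.aestronglyMeasurable (by fun_prop)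
  · rw [Set.uIoc_of_le zero_le_one] at hu
    have hu0 : 0 ≤ 1 - u := by linarith [hu.2]
    have hu1 : u ^ (j + 1) ≤ 1 := pow_le_one₀ hu.1.le hu.2
    have hu2 : 0 ≤ u ^ (j + 1) := pow_nonneg hu.1.le _
    have h1 : (1 - u) * u ^ (j + 1) ≤ 1 := by nlinarith [hu.1]
    have h2 : h * u ≤ |g| + 1 := by
      have h3 : |h| ≤ |g| + 1 := by
        rw [Metric.mem_ball, Real.dist_eq] at hh
        linarith [abs_sub_abs_le_abs_sub h g]
      calc h * u ≤ |h| * u := mul_le_mul_of_nonneg_right (le_abs_self h) hu.1.le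
        _ ≤ |h| * 1 := mul_le_mul_of_nonneg_left hu.2 (abs_nonneg h)
        _ ≤ |g| + 1 := by linarith
    rw [Real.norm_of_nonneg (by positivity)]
    calc _ ≤ 1 * Real.exp (h * u) := mul_le_mul_of_nonneg_right h1 (Real.exp_pos _).le
      _ ≤ _ := by rw [one_mul]; exact Real.exp_le_exp.2 h2
  · have h1 : HasDerivAt (fun h : ℝ => Real.exp (h * u)) (Real.exp (h * u) * u) h := by
      simpa using ((hasDerivAt_id h).mul_const u).exp
    exact (h1.const_mul ((1 - u) * u ^ j)).congr_deriv (by ring)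

/-- Integration by parts applied to `u ^ (j + 1) (1 - u) ^ 2 e ^ {g u}`. -/
lemma betaExp_recurrence (j : ℕ) (g : ℝ) :
    g * betaExp (j + 2) g = (j + 1) * betaExp j g + (g - j - 3) * betaExp (j + 1) g := by
  have hd : ∀ u : ℝ, HasDerivAt (fun u : ℝ => u ^ (j + 1) * (1 - u) ^ 2 * Real.exp (g * u))
      ((j + 1) * ((1 - u) * u ^ j * Real.exp (g * u))
        + (g - j - 3) * ((1 - u) * u ^ (j + 1) * Real.exp (g * u))
        - g * ((1 - u) * u ^ (j + 2) * Real.exp (g * u))) u := fun u => by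
    have h1 : HasDerivAt (fun u : ℝ => Real.exp (g * u)) (Real.exp (g * u) * g) u := by
      simpa using ((hasDerivAt_id u).const_mul g).exp
    have h2 : HasDerivAt (fun u : ℝ => (1 - u) ^ 2) (2 * (1 - u) * (-1)) u := by
      simpa using ((hasDerivAt_id u).const_sub 1).fun_pow 2
    refine (((hasDerivAt_pow (j + 1) u).mul h2).mul h1).congr_deriv ?_
    push_cast
    simp only [Pi.mul_apply]
    ring
  have hi : ∀ i : ℕ, IntervalIntegrable
      (fun u : ℝ => (1 - u) * u ^ i * Real.exp (g * u)) volume 0 1 :=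
    fun i => Continuous.intervalIntegrable (by fun_prop) _ _
  have h := intervalIntegral.integral_eq_sub_of_hasDerivAt (fun u _ => hd u)
    (Continuous.intervalIntegrable (by fun_prop) 0 1)
  rw [intervalIntegral.integral_sub (((hi _).const_mul _).add ((hi _).const_mul _))
    ((hi _).const_mul _), intervalIntegral.integral_add ((hi _).const_mul _) ((hi _).const_mul _)]
    at h
  simp only [intervalIntegral.integral_const_mul] at h
  simp only [betaExp]
  norm_num at h
  linarith

/-- A function vanishing at `0` and strictly increasing wherever it is nonpositive is positive. -/
lemma pos_of_deriv_pos_of_nonpos {N N' : ℝ → ℝ} (hc : ContinuousOn N (Set.Ici 0)) (h0 : N 0 = 0)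
    (hd : ∀ g, 0 < g → HasDerivAt N (N' g) g) (hN : ∀ g, 0 < g → N g ≤ 0 → 0 < N' g)
    {g : ℝ} (hg : 0 < g) : 0 < N g := by
  by_contra! hle
  obtain ⟨c, hc0, hcmin⟩ := isCompact_Icc.exists_isMinOn (Set.nonempty_Icc.2 hg.le)
    (hc.mono Set.Icc_subset_Ici_self)
  obtain ⟨d, hd0, hdg, hdmin⟩ : ∃ d, 0 < d ∧ d ≤ g ∧ IsMinOn N (Set.Icc 0 g) d := by
    rcases hc0.1.eq_or_lt with rfl | hpos
    · refine ⟨g, hg, le_rfl, fun t ht => ?_⟩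
      have := hcmin ht
      simp only [Set.mem_ofPred_eq] at this ⊢
      linarith
    · exact ⟨c, hpos, hc0.2, hcmin⟩
  have hNd : N d ≤ 0 := h0 ▸ hdmin (Set.left_mem_Icc.2 hg.le)
  have hpos := hN d hd0 hNd
  have hev := ((hasDerivAt_iff_tendsto_slope_left_right.1 (hd d hd0)).1).eventually
    (lt_mem_nhds hpos)
  obtain ⟨t, hslope, ht⟩ := (hev.and (Ioo_mem_nhdsLT hd0)).exists
  have hmin : N d ≤ N t := hdmin ⟨ht.1.le, ht.2.le.trans hdg⟩
  rw [slope_def_field] at hslope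
  exact absurd hslope (not_lt.2 (div_nonpos_of_nonneg_of_nonpos (by linarith) (by linarith [ht.2])))

/-- The tilted mean ratio `m = betaExp (n + 1) / betaExp n`. -/
noncomputable def betaExpMean (n : ℕ) (g : ℝ) : ℝ := betaExp (n + 1) g / betaExp n g

lemma betaExpMean_pos (n : ℕ) (g : ℝ) : 0 < betaExpMean n g :=
  div_pos (betaExp_pos _ _) (betaExp_pos _ _)

lemma exists_hasDerivAt_betaExpMean (n : ℕ) (g : ℝ) : ∃ m', HasDerivAt (betaExpMean n) m' g ∧
    g * m' = (n + 1) + (g - n - 3) * betaExpMean n g - g * betaExpMean n g ^ 2 := by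
  have ha := (betaExp_pos n g).ne'
  refine ⟨_, (hasDerivAt_betaExp (n + 1) g).div (hasDerivAt_betaExp n g) ha, ?_⟩
  have h := betaExp_recurrence n g
  unfold betaExpMean
  field_simp
  linear_combination (betaExp n g) * h

/-- The reciprocal of the critical point, as a function of the tilting parameter `g`. -/
noncomputable def invCrit (n : ℕ) (g : ℝ) : ℝ :=
  ((n + 1) + g * betaExpMean n g + 1) * betaExpMean n g / ((n + 1) + g * betaExpMean n g)

lemma invCrit_strictMonoOn (n : ℕ) : StrictMonoOn (invCrit n) (Set.Ioi 0) := by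
  set m := betaExpMean n
  set K : ℝ := n + 1 with hK
  have hK1 : 1 ≤ K := by simp [hK]
  set r : ℝ → ℝ := fun g => K + g * m g with hr
  set y := invCrit n
  have hyr : ∀ g, y g = (r g + 1) * m g / r g := fun g => rfl
  set s : ℝ → ℝ := fun g => r g + K / r g with hs
  set N : ℝ → ℝ := fun g => s g * (1 - y g) - y g with hN
  have hm_pos : ∀ g, 0 < m g := betaExpMean_pos n
  have hr_lt : ∀ g, 0 < g → K < r g := fun g hg => by
    have := mul_pos hg (hm_pos g)
    simp only [hr]; linarith
  have hr_le : ∀ g, 0 ≤ g → K ≤ r g := fun g hg => by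
    have := mul_nonneg hg (hm_pos g).le
    simp only [hr]; linarith
  have hmc : Continuous m := continuous_iff_continuousAt.2 fun g =>
    (exists_hasDerivAt_betaExpMean n g).choose_spec.1.continuousAt
  have hrc : Continuous r := by fun_prop
  have hr' : ∀ g, 0 < g → HasDerivAt r (r g * (1 - y g)) g := fun g hg => by
    obtain ⟨m', h1, h2⟩ := exists_hasDerivAt_betaExpMean n g
    have hr0 : r g ≠ 0 := by linarith [hr_lt g hg]
    refine (((hasDerivAt_id g).mul h1).const_add K).congr_deriv ?_
    rw [hyr]
    field_simp
    simp only [id, hr]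
    linear_combination h2
  have hy' : ∀ g, 0 < g → HasDerivAt y (N g / g) g := fun g hg => by
    have hr0 : 0 < r g := by linarith [hr_lt g hg]
    have h1 : HasDerivAt (fun g => (r g + (1 - K) - K * (r g)⁻¹) / g) (N g / g) g := by
      have h2 := ((((hr' g hg).add_const (1 - K)).fun_sub
        (((hr' g hg).fun_inv hr0.ne').const_mul K))).fun_div (hasDerivAt_id g) hg.ne'
      refine h2.congr_deriv ?_
      have h3 : g * m g = r g - K := by simp [hr]
      have h4 : y g * (r g * g) = (r g + 1) * (r g - K) := by
        rw [hyr, ← h3]; field_simp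
      simp only [hN, hs, id]
      field_simp
      linear_combination h4
    refine h1.congr_of_eventuallyEq ?_
    filter_upwards [Ioi_mem_nhds hg] with t ht
    have ht0 : (0 : ℝ) < t := ht
    have hr0 : 0 < r t := by linarith [hr_lt t ht]
    have h3 : m t = (r t - K) / t := by simp [hr]; field_simp
    rw [hyr, h3]
    field_simp
    ring
  have hyc : ContinuousOn y (Set.Ici 0) := by
    have : ContinuousOn (fun g => (r g + 1) * m g / r g) (Set.Ici 0) :=
      ContinuousOn.div (by fun_prop) hrc.continuousOn fun g hg => by
        have := hr_le g hg
        linarith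
    exact this
  have hsc : ContinuousOn s (Set.Ici 0) :=
    hrc.continuousOn.add (continuousOn_const.div hrc.continuousOn fun g hg => by
        have := hr_le g hg
        linarith)
  have hN0 : N 0 = 0 := by
    obtain ⟨m', -, h2⟩ := exists_hasDerivAt_betaExpMean n 0
    have h3 : (K + 2) * m 0 = K := by rw [hK]; linear_combination h2
    have h4 : m 0 = K / (K + 2) := by field_simp; linarith
    simp only [hN, hs, hyr, hr, zero_mul, h4]
    field_simp
    ring
  have hNpos : ∀ g, 0 < g → 0 < N g := fun g hg => by
    have hs' : ∀ g, 0 < g → HasDerivAt s ((1 - K / r g ^ 2) * (r g * (1 - y g))) g := fun g hg => by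
      have hr0 : 0 < r g := by linarith [hr_lt g hg]
      refine ((hr' g hg).add (((hr' g hg).inv hr0.ne').const_mul K)).congr_deriv ?_
      field_simp
      ring
    refine pos_of_deriv_pos_of_nonpos (N := N)
      (N' := fun g => ((1 - K / r g ^ 2) * (r g * (1 - y g))) * (1 - y g) + s g * (-(N g / g))
        - N g / g)
      ((hsc.mul (continuousOn_const.sub hyc)).sub hyc) hN0
      (fun g hg => ((hs' g hg).mul ((hy' g hg).const_sub 1)).sub (hy' g hg)) (fun g hg hle => ?_) hg
    have hr0 : 0 < r g := by linarith [hr_lt g hg]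
    have hs0 : 0 < s g := by simp only [hs]; positivity
    have hK2 : K / r g ^ 2 < 1 := by
      rw [div_lt_one (by positivity)]
      nlinarith [hr_lt g hg]
    have e : ((1 - K / r g ^ 2) * (r g * (1 - y g))) * (1 - y g) + s g * (-(N g / g)) - N g / g
        = (1 - K / r g ^ 2) * r g * (1 - y g) ^ 2 + (1 + s g) * (-N g / g) := by ring
    rw [e]
    have hc : 0 < (1 - K / r g ^ 2) * r g := mul_pos (by linarith) hr0
    rcases eq_or_ne (y g) 1 with h1 | h1
    · have : N g = -1 := by simp [hN, h1]
      rw [this, h1]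
      simp only [sub_self, neg_neg]
      positivity
    · have h2 : 0 < (1 - y g) ^ 2 := by
        have : 1 - y g ≠ 0 := sub_ne_zero.2 h1.symm
        positivity
      have h3 : 0 ≤ -N g / g := div_nonneg (by linarith) hg.le
      positivity
  refine strictMonoOn_of_deriv_pos (convex_Ioi 0) (hyc.mono Set.Ioi_subset_Ici_self) fun g hg => ?_
  rw [interior_Ioi] at hg
  rw [(hy' g hg).deriv]
  exact div_pos (hNpos g hg) hg

/-- The measure on `ℝ` with density `u` on `[0, ∞)`. -/
noncomputable def halfLineMeasure (u : ℝ → ℝ) : Measure ℝ :=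
  volume.withDensity fun y => ENNReal.ofReal (if 0 ≤ y then u y else 0)

instance sFinite_halfLineMeasure (u : ℝ → ℝ) : SFinite (halfLineMeasure u) := by
  unfold halfLineMeasure
  infer_instance

lemma measurable_ofReal_ite_nonneg {u : ℝ → ℝ} (hu : Continuous u) :
    Measurable fun y => ENNReal.ofReal (if 0 ≤ y then u y else 0) :=
  (Measurable.ite measurableSet_Ici hu.measurable measurable_const).ennreal_ofReal

lemma halfLineMeasure_congr {u v : ℝ → ℝ} (h : ∀ y, 0 ≤ y → u y = v y) :
    halfLineMeasure u = halfLineMeasure v := by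
  unfold halfLineMeasure
  congr 1
  funext y
  split_ifs with hy
  · rw [h y hy]
  · rfl

lemma halfLineMeasure_conv {u v : ℝ → ℝ} (hu : Continuous u) (hv : Continuous v)
    (hu0 : ∀ y, 0 ≤ y → 0 ≤ u y) (hv0 : ∀ y, 0 ≤ y → 0 ≤ v y) :
    halfLineMeasure u ∗ halfLineMeasure v =
      halfLineMeasure fun z => ∫ y in (0 : ℝ)..z, u y * v (z - y) := by
  unfold halfLineMeasure
  rw [conv_withDensity_eq_lconvolution (measurable_ofReal_ite_nonneg hu)
    (measurable_ofReal_ite_nonneg hv)]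
  congr 1
  funext z
  rw [lconvolution_def]
  have e : ∀ y, ENNReal.ofReal (if 0 ≤ y then u y else 0) *
      ENNReal.ofReal (if 0 ≤ -y + z then v (-y + z) else 0) =
      (Set.Icc 0 z).indicator (fun y => ENNReal.ofReal (u y * v (z - y))) y := fun y => by
    by_cases h0 : 0 ≤ y
    · by_cases h1 : y ≤ z
      · rw [if_pos h0, if_pos (by linarith), Set.indicator_of_mem (Set.mem_Icc.2 ⟨h0, h1⟩),
          ENNReal.ofReal_mul (hu0 y h0), neg_add_eq_sub]
      · rw [if_neg (show ¬ 0 ≤ -y + z by linarith), Set.indicator_of_notMem (fun h => h1 h.2)]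
        simp
    · rw [if_neg h0, Set.indicator_of_notMem (fun h => h0 h.1)]
      simp
  simp_rw [e]
  rw [lintegral_indicator measurableSet_Icc]
  split_ifs with hz
  · have hc : Continuous fun y => u y * v (z - y) := by fun_prop
    rw [intervalIntegral.integral_of_le hz, ← integral_Icc_eq_integral_Ioc,
      ofReal_integral_eq_lintegral_ofReal hc.continuousOn.integrableOn_Icc]
    refine (ae_restrict_iff' measurableSet_Icc).2 (.of_forall fun y hy => ?_)
    exact mul_nonneg (hu0 y hy.1) (hv0 _ (by linarith [hy.2]))
  · rw [Set.Icc_eq_empty hz]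
    simp

lemma map_mul_left_halfLineMeasure {u : ℝ → ℝ} (hu : Continuous u) {c : ℝ} (hc : 0 < c) :
    (halfLineMeasure u).map (c * ·) = halfLineMeasure fun z => c⁻¹ * u (c⁻¹ * z) := by
  unfold halfLineMeasure
  have hmc : Measurable fun y : ℝ => c * y := measurable_const_mul c
  refine Measure.ext_of_lintegral _ fun φ hφ => ?_
  have hm1 := measurable_ofReal_ite_nonneg hu
  have hm2 := measurable_ofReal_ite_nonneg (u := fun z => c⁻¹ * u (c⁻¹ * z)) (by fun_prop)
  have hm3 : Measurable fun z => ENNReal.ofReal (if 0 ≤ z then u (c⁻¹ * z) else 0) * φ z :=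
    (measurable_ofReal_ite_nonneg (u := fun z => u (c⁻¹ * z)) (by fun_prop)).mul hφ
  rw [lintegral_map hφ hmc, lintegral_withDensity_eq_lintegral_mul _ hm1 (g := fun y => φ (c * y)) (hφ.comp hmc),
    lintegral_withDensity_eq_lintegral_mul _ hm2 hφ]
  have hs : ∀ y : ℝ, 0 ≤ c * y ↔ 0 ≤ y := fun y => mul_nonneg_iff_of_pos_left hc
  have e : ∀ y, ((fun y => ENNReal.ofReal (if 0 ≤ y then u y else 0)) *
      fun y => φ (c * y)) y =
      (fun z => ENNReal.ofReal (if 0 ≤ z then u (c⁻¹ * z) else 0) * φ z) (c * y) := fun y => by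
    simp only [Pi.mul_apply, hs, inv_mul_cancel_left₀ hc.ne']
  rw [lintegral_congr e, ← lintegral_map (μ := volume) hm3 hmc,
    Real.map_volume_mul_left hc.ne', lintegral_smul_measure, smul_eq_mul,
    ← lintegral_const_mul _ hm3]
  refine lintegral_congr fun z => ?_
  rw [Pi.mul_apply, ← mul_assoc, abs_of_pos (inv_pos.2 hc),
    ← ENNReal.ofReal_mul (inv_pos.2 hc).le, mul_ite, mul_zero]

/-- The density on `[0, ∞)` of the gamma law with shape `n + 1` and rate `a`. -/
noncomputable def erlangDensity (n : ℕ) (a y : ℝ) : ℝ :=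
  a ^ (n + 1) * y ^ n / n.factorial * Real.exp (-(a * y))

lemma continuous_erlangDensity (n : ℕ) (a : ℝ) : Continuous (erlangDensity n a) := by
  unfold erlangDensity
  fun_prop

lemma erlangDensity_nonneg (n : ℕ) {a y : ℝ} (ha : 0 ≤ a) (hy : 0 ≤ y) :
    0 ≤ erlangDensity n a y := by
  unfold erlangDensity
  positivity

lemma expMeasure_one_eq : expMeasure 1 = halfLineMeasure (erlangDensity 0 1) := by
  unfold expMeasure gammaMeasure halfLineMeasure
  congr 1
  funext y
  simp [gammaPDF_eq, erlangDensity]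

lemma erlangDensity_conv (n : ℕ) :
    halfLineMeasure (erlangDensity n 1) ∗ halfLineMeasure (erlangDensity 0 1) =
      halfLineMeasure (erlangDensity (n + 1) 1) := by
  rw [halfLineMeasure_conv (continuous_erlangDensity _ _) (continuous_erlangDensity _ _)
    (fun y => erlangDensity_nonneg _ zero_le_one) (fun y => erlangDensity_nonneg _ zero_le_one)]
  refine halfLineMeasure_congr fun z hz => ?_
  have e : ∀ y, erlangDensity n 1 y * erlangDensity 0 1 (z - y) =
      (Real.exp (-z) / n.factorial) * y ^ n := fun y => by
    have h : Real.exp (-z) = Real.exp (-y) * Real.exp (-(z - y)) := by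
      rw [← Real.exp_add]; ring_nf
    simp only [erlangDensity, h]
    simp
    ring
  simp_rw [e]
  rw [intervalIntegral.integral_const_mul, integral_pow, erlangDensity, Nat.factorial_succ]
  push_cast
  simp
  field_simp

instance isProbabilityMeasure_expLaw (t : ℕ) : IsProbabilityMeasure (expLaw t) := by
  have := isProbabilityMeasure_expMeasure one_pos
  unfold expLaw
  infer_instance

lemma map_sum_expLaw_succ (t : ℕ) :
    (expLaw (t + 1)).map (fun v => ∑ j, v j) =
      (expLaw t).map (fun v => ∑ j, v j) ∗ expMeasure 1 := by
  have := isProbabilityMeasure_expMeasure one_pos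
  have hmp := measurePreserving_piFinSuccAbove (fun _ : Fin (t + 1) => expMeasure 1) 0
  have hs : Measurable fun v : Fin t → ℝ => ∑ j, v j := by fun_prop
  have : (fun v : Fin (t + 1) → ℝ => ∑ j, v j) =
      (fun z : ℝ × ℝ => z.1 + z.2) ∘ (Prod.map id fun v : Fin t → ℝ => ∑ j, v j) ∘
        MeasurableEquiv.piFinSuccAbove (fun _ => ℝ) 0 := by
    funext v
    simp [Fin.sum_univ_succ, Fin.tail]
  rw [Measure.conv_comm, Measure.conv, this,
    ← Measure.map_map (by fun_prop) (by fun_prop),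
    ← Measure.map_map (by fun_prop) (by fun_prop)]
  have h1 := hmp.map_eq
  have h2 := Measure.map_prod_map (expMeasure 1) (expLaw t) measurable_id hs
  rw [Measure.map_id] at h2
  rw [h2]
  congr 2

lemma map_sum_expLaw (n : ℕ) :
    (expLaw (n + 1)).map (fun v => ∑ j, v j) = halfLineMeasure (erlangDensity n 1) := by
  induction n with
  | zero =>
    rw [map_sum_expLaw_succ]
    have h0 : (fun v : Fin 0 → ℝ => ∑ j, v j) = fun _ => 0 := by funext v; simp
    have := isProbabilityMeasure_expMeasure one_pos
    rw [h0, Measure.map_const, measure_univ, one_smul,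
      Measure.dirac_zero_conv, expMeasure_one_eq]
  | succ n ih => rw [map_sum_expLaw_succ, ih, expMeasure_one_eq, erlangDensity_conv]

lemma map_mul_sum_expLaw (n : ℕ) {c : ℝ} (hc : 0 < c) :
    (expLaw (n + 1)).map (fun v => c * ∑ j, v j) = halfLineMeasure (erlangDensity n c⁻¹) := by
  have : (fun v : Fin (n + 1) → ℝ => c * ∑ j, v j) = (c * ·) ∘ fun v => ∑ j, v j := rfl
  rw [this, ← Measure.map_map (by fun_prop) (by fun_prop), map_sum_expLaw,
    map_mul_left_halfLineMeasure (continuous_erlangDensity _ _) hc]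
  refine halfLineMeasure_congr fun z _ => ?_
  simp only [erlangDensity, one_pow, one_mul]
  ring

/-- The incomplete exponential moment `∫₀ˣ y ^ j e ^ {γ y} dy`. -/
noncomputable def expMoment (γ : ℝ) (j : ℕ) (x : ℝ) : ℝ :=
  ∫ y in (0 : ℝ)..x, y ^ j * Real.exp (γ * y)

lemma mixedLaw_eq {k : ℕ} (hk : 1 ≤ k) {p : ℝ} (hp0 : 0 < p) (hp1 : p < 1) :
    mixedLaw k p = halfLineMeasure fun z =>
      (p⁻¹ ^ 2 * (k / (1 - p)) ^ (k + 1) / k.factorial) * (Real.exp (-(p⁻¹ * z)) *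
        (z * expMoment (p⁻¹ - k / (1 - p)) k z - expMoment (p⁻¹ - k / (1 - p)) (k + 1) z)) := by
  have hk0 : (0 : ℝ) < k := by exact_mod_cast hk
  have hb : 0 < (1 - p) / k := div_pos (by linarith) hk0
  have hβ : 0 < k / (1 - p) := div_pos hk0 (by linarith)
  have hfun : (fun v : (Fin 2 → ℝ) × (Fin (k + 1) → ℝ) =>
      p * (v.1 0 + v.1 1) + ((1 - p) / k) * ∑ j, v.2 j) =
      (fun z : ℝ × ℝ => z.1 + z.2) ∘
        Prod.map (fun v => p * ∑ j, v j) (fun w => ((1 - p) / k) * ∑ j, w j) := by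
    funext v
    simp [Fin.sum_univ_two]
  rw [mixedLaw, hfun, ← Measure.map_map (by fun_prop) (by fun_prop),
    ← Measure.map_prod_map _ _ (by fun_prop) (by fun_prop), ← Measure.conv,
    map_mul_sum_expLaw 1 hp0, map_mul_sum_expLaw k hb, Measure.conv_comm, inv_div,
    halfLineMeasure_conv (continuous_erlangDensity _ _) (continuous_erlangDensity _ _)
    (fun y => erlangDensity_nonneg _ hβ.le) (fun y => erlangDensity_nonneg _ (inv_pos.2 hp0).le)]
  refine halfLineMeasure_congr fun z _ => ?_
  generalize (k : ℝ) / (1 - p) = β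
  generalize p⁻¹ = α
  have e : ∀ y, erlangDensity k β y * erlangDensity 1 α (z - y) =
      (α ^ 2 * β ^ (k + 1) / k.factorial) * (Real.exp (-(α * z)) *
        (z * (y ^ k * Real.exp ((α - β) * y)) - y ^ (k + 1) * Real.exp ((α - β) * y))) := by
    intro y
    have h : Real.exp (-(β * y)) * Real.exp (-(α * (z - y))) =
        Real.exp (-(α * z)) * Real.exp ((α - β) * y) := by
      rw [← Real.exp_add, ← Real.exp_add]; ring_nf
    simp only [erlangDensity, Nat.factorial_one, Nat.cast_one, pow_one, div_one, one_add_one_eq_two]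
    linear_combination (β ^ (k + 1) * y ^ k / k.factorial * (α ^ 2 * (z - y))) * h
  have hi : ∀ j, IntervalIntegrable (fun y => y ^ j * Real.exp ((α - β) * y)) volume 0 z :=
    fun j => Continuous.intervalIntegrable (by fun_prop) _ _
  simp_rw [e]
  rw [intervalIntegral.integral_const_mul, intervalIntegral.integral_const_mul,
    intervalIntegral.integral_sub ((hi _).const_mul _) (hi _), intervalIntegral.integral_const_mul]
  rfl

lemma hasDerivAt_expMoment (γ : ℝ) (j : ℕ) (x : ℝ) :
    HasDerivAt (expMoment γ j) (x ^ j * Real.exp (γ * x)) x :=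
  (Continuous.integral_hasStrictDerivAt (f := fun y => y ^ j * Real.exp (γ * y))
    (by fun_prop) 0 x).hasDerivAt

/-- A continuous density agreeing with that of `halfLineMeasure u` equals `u` on `(0, ∞)`. -/
lemma eqOn_of_halfLineMeasure_eq {u f : ℝ → ℝ} (hu : Continuous u) (hf : Continuous f)
    (hpos : ∀ y, 0 < y → 0 < u y)
    (h : halfLineMeasure u = volume.withDensity fun y => ENNReal.ofReal (f y)) :
    Set.EqOn f u (Set.Ioi 0) := by
  rw [halfLineMeasure, withDensity_eq_iff_of_sigmaFinite
    (measurable_ofReal_ite_nonneg hu).aemeasurable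
    hf.measurable.ennreal_ofReal.aemeasurable] at h
  have h' : (fun y => ENNReal.ofReal (u y)) =ᵐ[volume.restrict (Set.Ioi 0)]
      fun y => ENNReal.ofReal (f y) := by
    filter_upwards [ae_restrict_of_ae h, ae_restrict_mem measurableSet_Ioi] with y hy hy0
    rwa [if_pos (le_of_lt hy0)] at hy
  have heq := Measure.eqOn_open_of_ae_eq h' isOpen_Ioi
    (ENNReal.continuous_ofReal.comp hu).continuousOn
    (ENNReal.continuous_ofReal.comp hf).continuousOn
  intro y hy
  have h1 : ENNReal.ofReal (u y) = ENNReal.ofReal (f y) := heq hy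
  have h2 := hpos y hy
  have h3 : 0 < f y := by
    rw [← ENNReal.ofReal_pos, ← h1, ENNReal.ofReal_pos]
    exact h2
  exact ((ENNReal.ofReal_eq_ofReal_iff h2.le h3.le).1 h1).symm

lemma betaExp_scale (j : ℕ) (γ x : ℝ) :
    x * expMoment γ j x - expMoment γ (j + 1) x = x ^ (j + 2) * betaExp j (γ * x) := by
  have hi : ∀ i : ℕ, IntervalIntegrable (fun y : ℝ => y ^ i * Real.exp (γ * y)) volume 0 x :=
    fun i => Continuous.intervalIntegrable (by fun_prop) _ _
  have h := intervalIntegral.smul_integral_comp_mul_left (a := 0) (b := 1)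
    (fun y : ℝ => x * (y ^ j * Real.exp (γ * y)) - y ^ (j + 1) * Real.exp (γ * y)) x
  rw [mul_zero, mul_one, intervalIntegral.integral_sub ((hi _).const_mul _) (hi _),
    intervalIntegral.integral_const_mul, smul_eq_mul] at h
  simp only [expMoment, betaExp]
  rw [← h, ← intervalIntegral.integral_const_mul, ← intervalIntegral.integral_const_mul]
  refine intervalIntegral.integral_congr fun u _ => ?_
  simp only [mul_assoc γ x u]
  ring

lemma expMoment_recurrence (γ : ℝ) (j : ℕ) (x : ℝ) :
    (j + 1) * expMoment γ j x + γ * expMoment γ (j + 1) x = x ^ (j + 1) * Real.exp (γ * x) := by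
  have hd : ∀ y : ℝ, HasDerivAt (fun y : ℝ => y ^ (j + 1) * Real.exp (γ * y))
      ((j + 1) * (y ^ j * Real.exp (γ * y)) + γ * (y ^ (j + 1) * Real.exp (γ * y))) y := fun y => by
    have h1 : HasDerivAt (fun y : ℝ => Real.exp (γ * y)) (Real.exp (γ * y) * γ) y := by
      simpa using ((hasDerivAt_id y).const_mul γ).exp
    refine ((hasDerivAt_pow (j + 1) y).mul h1).congr_deriv ?_
    push_cast
    ring
  have hi : ∀ i : ℕ, IntervalIntegrable (fun y : ℝ => y ^ i * Real.exp (γ * y)) volume 0 x :=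
    fun i => Continuous.intervalIntegrable (by fun_prop) _ _
  have h := intervalIntegral.integral_eq_sub_of_hasDerivAt (fun y _ => hd y)
    (((hi _).const_mul _).add ((hi _).const_mul _))
  rw [intervalIntegral.integral_add ((hi _).const_mul _) ((hi _).const_mul _)] at h
  simp only [intervalIntegral.integral_const_mul] at h
  simpa [expMoment] using h

/-- A critical point of the density with rates `α` and `β`, after integration by parts. -/
lemma betaExp_eq_of_deriv_eq_zero {n : ℕ} {α β C x : ℝ} (hC : C ≠ 0) (hx : 0 < x)
    (h : deriv (fun z => C * (Real.exp (-(α * z)) * (z * expMoment (α - β) (n + 1) z -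
      expMoment (α - β) (n + 2) z))) x = 0) :
    (n + 1) * betaExp n ((α - β) * x) = β * x * betaExp (n + 1) ((α - β) * x) := by
  have h1 : HasDerivAt (fun z : ℝ => Real.exp (-(α * z))) (Real.exp (-(α * x)) * -α) x := by
    simpa using ((hasDerivAt_id x).const_mul α).neg.exp
  have h2 := (((hasDerivAt_id x).mul (hasDerivAt_expMoment (α - β) (n + 1) x)).sub
    (hasDerivAt_expMoment (α - β) (n + 2) x))
  have h3 : deriv (fun z => C * (Real.exp (-(α * z)) * (z * expMoment (α - β) (n + 1) z -
      expMoment (α - β) (n + 2) z))) x = C * (Real.exp (-(α * x)) * (expMoment (α - β) (n + 1) x -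
      α * (x * expMoment (α - β) (n + 1) x - expMoment (α - β) (n + 2) x))) := by
    refine (((h1.mul h2).const_mul C).congr_deriv ?_).deriv
    simp only [Pi.sub_apply, Pi.mul_apply, id]
    ring
  rw [h3, mul_eq_zero, mul_eq_zero] at h
  have h4 := (h.resolve_left hC).resolve_left (Real.exp_pos _).ne'
  have h5 := expMoment_recurrence (α - β) n x
  have h6 := expMoment_recurrence (α - β) (n + 1) x
  have h7 := betaExp_scale n (α - β) x
  have h8 := betaExp_scale (n + 1) (α - β) x
  have hx2 : x ^ (n + 2) ≠ 0 := (pow_pos hx _).ne'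
  refine mul_left_cancel₀ hx2 ?_
  push_cast at h6
  linear_combination h4 + x * h5 - h6 - (n + 1) * h7 + β * h8

lemma invCrit_of_deriv_eq_zero {n : ℕ} {p x : ℝ} (hp0 : 0 < p) (hp1 : p < 1 / ((n + 1 : ℕ) + 1 : ℝ))
    (hx : 0 < x) {f : ℝ → ℝ} (hf : Continuous f)
    (hf_density : mixedLaw (n + 1) p = volume.withDensity fun y => ENNReal.ofReal (f y))
    (h : deriv f x = 0) :
    ∃ g, 0 < g ∧ (n + 1) + g * betaExpMean n g = (1 - p) / p ∧ invCrit n g = x⁻¹ := by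
  have hn : (0 : ℝ) ≤ n := n.cast_nonneg
  rw [lt_div_iff₀ (by positivity)] at hp1
  push_cast at hp1
  have hp2 : 0 < 1 - p := by nlinarith
  set β : ℝ := ((n + 1 : ℕ) : ℝ) / (1 - p) with hβ
  have hβ0 : 0 < β := by positivity
  set C : ℝ := p⁻¹ ^ 2 * β ^ (n + 1 + 1) / (n + 1).factorial with hC
  have hC0 : 0 < C := by positivity
  rw [mixedLaw_eq (Nat.le_add_left 1 n) hp0 (by linarith)] at hf_density
  have hcm : ∀ j, Continuous (expMoment (p⁻¹ - β) j) := fun j =>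
    continuous_iff_continuousAt.2 fun z => (hasDerivAt_expMoment _ _ z).continuousAt
  have hu : Continuous fun z => C * (Real.exp (-(p⁻¹ * z)) *
      (z * expMoment (p⁻¹ - β) (n + 1) z - expMoment (p⁻¹ - β) (n + 2) z)) := by
    have h1 := hcm (n + 1)
    have h2 := hcm (n + 2)
    fun_prop
  have heq := eqOn_of_halfLineMeasure_eq hu hf (fun y hy => by
    rw [betaExp_scale]
    have := betaExp_pos (n + 1) ((p⁻¹ - β) * y)
    positivity) hf_density
  rw [(Filter.eventuallyEq_of_mem (Ioi_mem_nhds hx) heq).deriv_eq] at h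
  have hcrit := betaExp_eq_of_deriv_eq_zero hC0.ne' hx h
  have hγ : p⁻¹ - β = (1 - (n + 2) * p) / (p * (1 - p)) := by
    rw [hβ]; push_cast; field_simp; ring
  have hg : 0 < (p⁻¹ - β) * x := by
    rw [hγ]
    exact mul_pos (div_pos (by nlinarith) (by positivity)) hx
  set g := (p⁻¹ - β) * x with hgdef
  have ha := betaExp_pos n g
  have hm : betaExpMean n g = (1 - p) / x := by
    unfold betaExpMean
    rw [hβ] at hcrit
    push_cast at hcrit
    field_simp at hcrit ⊢
    linarith
  have hr : (n + 1) + g * betaExpMean n g = (1 - p) / p := by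
    rw [hm, hgdef, hγ]
    field_simp
    ring
  refine ⟨g, hg, hr, ?_⟩
  rw [invCrit, hr, hm]
  field_simp
  ring

/-- fix `k ≥ 1` and `x > 0`. There do not exist distinct
`p, q ∈ (0, 1/(k+1))` such that the (continuous) densities `f_{p,2,k+1}` and `f_{q,2,k+1}`
of `p(X₁+X₂) + ((1−p)/k)(Y₁+⋯+Y_{k+1})`, resp. with `q` in place of `p`, both have a
critical point at `x`; equivalently, the mode `x*(p)` is an injective (indeed strictly
increasing) function of `p`. -/
theorem no_common_critical_point (k : ℕ) (hk : 1 ≤ k) (x : ℝ) (hx : 0 < x)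
    (p q : ℝ) (hp : p ∈ Set.Ioo (0 : ℝ) (1 / ((k : ℝ) + 1)))
    (hq : q ∈ Set.Ioo (0 : ℝ) (1 / ((k : ℝ) + 1))) (hpq : p ≠ q)
    (fp fq : ℝ → ℝ) (hfp_cont : Continuous fp) (hfq_cont : Continuous fq)
    (hfp_density : mixedLaw k p =
      MeasureTheory.volume.withDensity fun y => ENNReal.ofReal (fp y))
    (hfq_density : mixedLaw k q =
      MeasureTheory.volume.withDensity fun y => ENNReal.ofReal (fq y)) :
    ¬ (deriv fp x = 0 ∧ deriv fq x = 0) := by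
  rintro ⟨hp', hq'⟩
  obtain ⟨n, rfl⟩ := Nat.exists_eq_add_of_le' hk
  obtain ⟨g, hg, hrp, hyp⟩ := invCrit_of_deriv_eq_zero hp.1 hp.2 hx hfp_cont hfp_density hp'
  obtain ⟨g', hg', hrq, hyq⟩ := invCrit_of_deriv_eq_zero hq.1 hq.2 hx hfq_cont hfq_density hq'
  have hgg : g = g' := (invCrit_strictMonoOn n).injOn hg hg' (hyp.trans hyq.symm)
  subst hgg
  have hp0 : p ≠ 0 := hp.1.ne'
  have hq0 : q ≠ 0 := hq.1.ne'
  have h := hrp.symm.trans hrq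
  rw [div_eq_div_iff hp0 hq0] at h
  exact hpq (by linarith)
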